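/- Let d ≥ 3 and g(x) = |x|^{2-d} on ℝ^d. Assume V : ℝ^d → ℝ ∪ {+∞} is lower semi-continuous, bounded below, finite on a set of positive Lebesgue measure, and satisfies the growth condition lim_{|x|→∞} (V(x)/2 + g(x)) = +∞. Then the functional I_V(μ) = ∬ g(x-y) dμ(x)dμ(y) + ∫ V dμ admits a minimizer over the space of Borel probability measures on ℝ^d, the minimum value is finite, the minimizer is unique, and it has compact support. -/

import Mathlib

open MeasureTheory Filter Topology
open scoped ENNReal

noncomputable section

/-- The ambient Euclidean space `ℝ^d`. -/
abbrev Esp (d : ℕ) := EuclideanSpace ℝ (Fin d)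

/-- The Coulomb kernel `g(x) = |x|^(2-d)` in dimension `d ≥ 3`, with values in `[0,∞]`
(it equals `+∞` at the origin, since `2 - d < 0`). -/
def coulK (d : ℕ) (x : Esp d) : ℝ≥0∞ := (ENNReal.ofReal ‖x‖) ^ (2 - (d : ℝ))

/-- The Coulomb interaction energy `∬ g(x-y) dμ(x) dμ(y) ∈ [0,∞]`. -/
def doubleEnergy (d : ℕ) (μ : Measure (Esp d)) : ℝ≥0∞ :=
  ∫⁻ p : Esp d × Esp d, coulK d (p.1 - p.2) ∂(μ.prod μ)

/-- The integral of an extended-real-valued function, defined as the (extended-real)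
difference of the integrals of the positive and negative parts. -/
def eIntE {α : Type*} [MeasurableSpace α] (μ : Measure α) (f : α → EReal) : EReal :=
  ((∫⁻ x, (if f x = ⊤ then ⊤ else ENNReal.ofReal (f x).toReal) ∂μ : ℝ≥0∞) : EReal)
    - ((∫⁻ x, (if f x = ⊥ then ⊤ else ENNReal.ofReal (-(f x)).toReal) ∂μ : ℝ≥0∞) : EReal)

/-- The mean-field energy functional `I_V(μ) = ∬ g(x-y) dμ(x)dμ(y) + ∫ V dμ`,
with values in `(-∞, +∞]` (for `V` bounded below), for the Coulomb kernel in dimension `d ≥ 3`. -/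
def IV (d : ℕ) (V : Esp d → EReal) (μ : Measure (Esp d)) : EReal :=
  (doubleEnergy d μ : EReal) + eIntE μ V

/-- The measure `r^(1 - 2 * d) dr` on `(0, ∞)`. -/
def radiusMeasure (d : ℕ) : Measure ℝ :=
  (volume.restrict (Set.Ioi 0)).withDensity (fun r => ENNReal.ofReal (r ^ (1 - 2 * (d : ℝ))))

instance (d : ℕ) : SigmaFinite (radiusMeasure d) := by
  unfold radiusMeasure
  exact SigmaFinite.withDensity_ofReal _

theorem lintegral_radiusMeasure (d : ℕ) (f : ℝ → ℝ≥0∞) :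
    ∫⁻ r, f r ∂radiusMeasure d
      = ∫⁻ r in Set.Ioi 0, ENNReal.ofReal (r ^ (1 - 2 * (d : ℝ))) * f r := by
  unfold radiusMeasure
  rw [lintegral_withDensity_eq_lintegral_mul_non_measurable]
  · rfl
  · fun_prop
  · simp

theorem lintegral_radiusMeasure_comp_mul (d : ℕ) (f : ℝ → ℝ≥0∞) {l : ℝ} (hl : 0 < l) :
    ∫⁻ r, f r ∂radiusMeasure d
      = ENNReal.ofReal (l ^ (2 - 2 * (d : ℝ))) * ∫⁻ r, f (l * r) ∂radiusMeasure d := by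
  rw [lintegral_radiusMeasure, lintegral_radiusMeasure]
  have h1 : (fun r : ℝ => l * r) '' Set.Ioi 0 = Set.Ioi 0 := by
    rw [Set.image_mul_left_Ioi hl, mul_zero]
  have h2 := lintegral_image_eq_lintegral_abs_deriv_mul (s := Set.Ioi (0 : ℝ))
    (f := fun r => l * r) (f' := fun _ => l) measurableSet_Ioi
    (fun x _ => by simpa using ((hasDerivAt_id x).const_mul l).hasDerivWithinAt)
    (fun x _ y _ h => mul_left_cancel₀ hl.ne' h)
    (fun r => ENNReal.ofReal (r ^ (1 - 2 * (d : ℝ))) * f r)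
  rw [h1] at h2
  rw [h2, ← lintegral_const_mul' _ _ ENNReal.ofReal_ne_top]
  refine setLIntegral_congr_fun measurableSet_Ioi fun r hr => ?_
  have hr : 0 < r := hr
  rw [← mul_assoc, ← mul_assoc, ← ENNReal.ofReal_mul (abs_nonneg _),
    ← ENNReal.ofReal_mul (by positivity), abs_of_pos hl, Real.mul_rpow hl.le hr.le, ← mul_assoc]
  congr 3
  rw [show 2 - 2 * (d : ℝ) = 1 + (1 - 2 * (d : ℝ)) by ring, Real.rpow_add hl, Real.rpow_one]

theorem radiusMeasure_Ioo_pos (d : ℕ) {a b : ℝ} (ha : 0 ≤ a) (hab : a < b) :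
    0 < radiusMeasure d (Set.Ioo a b) := by
  rw [pos_iff_ne_zero]
  intro h
  unfold radiusMeasure at h
  rw [withDensity_apply_eq_zero (by fun_prop), Measure.restrict_apply' measurableSet_Ioi] at h
  refine absurd (measure_mono_null (s := Set.Ioo a b) ?_ h) (by simp [hab])
  intro r hr
  have : 0 < r := ha.trans_lt hr.1
  exact ⟨⟨by simpa using by positivity, hr⟩, this⟩

/-- The volume of the intersection of two balls of radius `r` with centres `x` apart, integrated
over all radii. -/
def ballKernel (d : ℕ) (x : Esp d) : ℝ≥0∞ :=
  ∫⁻ r, volume (Metric.ball (0 : Esp d) r ∩ Metric.ball x r) ∂radiusMeasure d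

theorem ballKernel_smul (d : ℕ) (x : Esp d) {l : ℝ} (hl : 0 < l) :
    ballKernel d (l • x) = ENNReal.ofReal (l ^ (2 - (d : ℝ))) * ballKernel d x := by
  unfold ballKernel
  rw [lintegral_radiusMeasure_comp_mul d _ hl]
  have h (r : ℝ) : volume (Metric.ball (0 : Esp d) (l * r) ∩ Metric.ball (l • x) (l * r))
      = ENNReal.ofReal (l ^ d) * volume (Metric.ball (0 : Esp d) r ∩ Metric.ball x r) := by
    have := Measure.addHaar_smul_of_nonneg (volume : Measure (Esp d)) hl.le
      (Metric.ball (0 : Esp d) r ∩ Metric.ball x r)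
    rw [finrank_euclideanSpace_fin] at this
    rw [← this, Set.smul_set_inter₀ hl.ne', smul_ball hl.ne', smul_ball hl.ne', smul_zero,
      Real.norm_of_nonneg hl.le]
  simp_rw [h]
  rw [lintegral_const_mul' _ _ ENNReal.ofReal_ne_top, ← mul_assoc,
    ← ENNReal.ofReal_mul (by positivity), ← Real.rpow_natCast, ← Real.rpow_add hl]
  congr 3
  ring

theorem ballKernel_eq_of_norm_eq (d : ℕ) {x y : Esp d} (h : ‖x‖ = ‖y‖) :
    ballKernel d x = ballKernel d y := by
  set R := (ℝ ∙ (x - y))ᗮ.reflection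
  have hR : R x = y := Submodule.reflection_sub h
  unfold ballKernel
  congr 1 with r
  rw [← R.measurePreserving.measure_preimage (s := Metric.ball (0 : Esp d) r ∩ Metric.ball y r)
    (by measurability), Set.preimage_inter, R.preimage_ball, R.preimage_ball, map_zero,
    (R.symm_apply_eq).2 hR.symm]

theorem ballKernel_ne_zero (d : ℕ) {x : Esp d} (h : ‖x‖ = 1) : ballKernel d x ≠ 0 := by
  unfold ballKernel
  have hpos : 0 < radiusMeasure d (Set.Ioo 1 2) := radiusMeasure_Ioo_pos d zero_le_one one_lt_two
  set c := volume (Metric.ball (0 : Esp d) 1 ∩ Metric.ball x 1)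
  have hc : 0 < c := by
    refine (Metric.isOpen_ball.inter Metric.isOpen_ball).measure_pos _ ⟨(2⁻¹ : ℝ) • x, ?_, ?_⟩
    · simp only [mem_ball_zero_iff, norm_smul, h]; norm_num
    · rw [Metric.mem_ball, dist_eq_norm, show (2⁻¹ : ℝ) • x - x = (-2⁻¹ : ℝ) • x by module]
      simp only [norm_smul, h]; norm_num
  refine (lt_of_lt_of_le (ENNReal.mul_pos hc.ne' hpos.ne') ?_).ne'
  rw [← setLIntegral_const]
  refine (setLIntegral_mono' measurableSet_Ioo fun r hr => ?_).trans (setLIntegral_le_lintegral _ _)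
  exact measure_mono (Set.inter_subset_inter (Metric.ball_subset_ball hr.1.le)
    (Metric.ball_subset_ball hr.1.le))

theorem ballKernel_ne_top {d : ℕ} (hd : 3 ≤ d) {x : Esp d} (h : ‖x‖ = 1) :
    ballKernel d x ≠ ⊤ := by
  have : Nontrivial (Esp d) := ⟨⟨x, 0, by rintro rfl; simp at h⟩⟩
  have hd' : (3 : ℝ) ≤ d := by exact_mod_cast hd
  unfold ballKernel
  rw [lintegral_radiusMeasure]
  set c := volume (Metric.ball (0 : Esp d) 1)
  have hb (r : ℝ) (hr : r ∈ Set.Ioi (0 : ℝ)) : ENNReal.ofReal (r ^ (1 - 2 * (d : ℝ))) *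
      volume (Metric.ball (0 : Esp d) r ∩ Metric.ball x r)
      ≤ (Set.Ioi (2⁻¹ : ℝ)).indicator (fun r => ENNReal.ofReal (r ^ (1 - (d : ℝ))) * c) r := by
    have hr : 0 < r := hr
    by_cases h2 : r ∈ Set.Ioi (2⁻¹ : ℝ)
    · rw [Set.indicator_of_mem h2]
      calc _ ≤ ENNReal.ofReal (r ^ (1 - 2 * (d : ℝ))) * volume (Metric.ball (0 : Esp d) r) := by
            gcongr; exact Set.inter_subset_left
        _ = _ := by
          rw [Measure.addHaar_ball_of_pos _ _ hr, finrank_euclideanSpace_fin, ← mul_assoc,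
            ← ENNReal.ofReal_mul (by positivity), ← Real.rpow_natCast, ← Real.rpow_add hr]
          congr 3; ring
    · have h2 : r ≤ 2⁻¹ := not_lt.1 h2
      have : Metric.ball (0 : Esp d) r ∩ Metric.ball x r = ∅ := by
        refine Set.disjoint_iff_inter_eq_empty.1 (Metric.ball_disjoint_ball ?_)
        rw [dist_zero_left, h]; linarith
      simp [this]
  refine ne_top_of_le_ne_top ?_ (setLIntegral_mono' measurableSet_Ioi hb)
  refine ne_top_of_le_ne_top ?_ (setLIntegral_le_lintegral _ _)
  rw [lintegral_indicator measurableSet_Ioi, lintegral_mul_const _ (by fun_prop)]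
  refine ENNReal.mul_ne_top ?_ measure_ball_lt_top.ne
  have hi := (integrableOn_Ioi_rpow_of_lt (a := 1 - (d : ℝ)) (by linarith)
    (show (0 : ℝ) < 2⁻¹ by norm_num))
  exact hi.lintegral_lt_top.ne

theorem coulK_of_ne_zero (d : ℕ) {x : Esp d} (hx : x ≠ 0) :
    coulK d x = ENNReal.ofReal (‖x‖ ^ (2 - (d : ℝ))) := by
  rw [coulK, ENNReal.ofReal_rpow_of_pos (norm_pos_iff.2 hx)]

theorem coulK_zero {d : ℕ} (hd : 3 ≤ d) : coulK d 0 = ⊤ := by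
  have hd' : (3 : ℝ) ≤ d := by exact_mod_cast hd
  rw [coulK, norm_zero, ENNReal.ofReal_zero, ENNReal.zero_rpow_of_neg (by linarith)]

/-- The Coulomb kernel is a superposition of autocorrelations of indicators of balls. -/
theorem exists_ballKernel_eq_mul_coulK {d : ℕ} (hd : 3 ≤ d) :
    ∃ C : ℝ≥0∞, C ≠ 0 ∧ C ≠ ⊤ ∧ ∀ x, ballKernel d x = C * coulK d x := by
  have hd' : (3 : ℝ) ≤ d := by exact_mod_cast hd
  obtain ⟨e, he⟩ : ∃ e : Esp d, ‖e‖ = 1 :=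
    ⟨EuclideanSpace.single ⟨0, by omega⟩ 1, by simp⟩
  have hne (x : Esp d) (hx : x ≠ 0) : ballKernel d x = ballKernel d e * coulK d x := by
    have hx' : 0 < ‖x‖ := norm_pos_iff.2 hx
    rw [ballKernel_eq_of_norm_eq d (y := ‖x‖ • e) (by simp [norm_smul, he]),
      ballKernel_smul d e hx', coulK_of_ne_zero d hx, mul_comm]
  refine ⟨ballKernel d e, ballKernel_ne_zero d he, ballKernel_ne_top hd he, fun x => ?_⟩
  rcases eq_or_ne x 0 with rfl | hx
  · rw [coulK_zero hd, ENNReal.mul_top (ballKernel_ne_zero d he)]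
    have hle (l : ℝ) (hl : 0 < l) :
        ENNReal.ofReal (l ^ (2 - (d : ℝ))) * ballKernel d e ≤ ballKernel d 0 := by
      rw [← ballKernel_smul d e hl]
      unfold ballKernel
      exact lintegral_mono fun r => measure_mono (by simp)
    have ht : Tendsto (fun l : ℝ => ENNReal.ofReal (l ^ (2 - (d : ℝ))) * ballKernel d e)
        (𝓝[>] 0) (𝓝 ⊤) := by
      have := (ENNReal.tendsto_ofReal_atTop.comp
        (tendsto_rpow_neg_nhdsGT_zero (y := 2 - (d : ℝ)) (by linarith)))
      have h2 := ENNReal.Tendsto.mul_const (b := ballKernel d e) this (Or.inl ENNReal.top_ne_zero)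
      rwa [ENNReal.top_mul (ballKernel_ne_zero d he)] at h2
    exact top_le_iff.1 (le_of_tendsto ht (eventually_mem_nhdsWithin.mono fun l hl => hle l hl))
  · exact hne x hx

/-- The measure `r^(1 - 2 * d) dr dz` on pairs (radius, centre). -/
def ballMeasure (d : ℕ) : Measure (ℝ × Esp d) := (radiusMeasure d).prod volume

instance (d : ℕ) : SFinite (ballMeasure d) := by
  unfold ballMeasure
  infer_instance

theorem measurable_measure_ball {d : ℕ} (μ : Measure (Esp d)) [SFinite μ] :
    Measurable fun q : ℝ × Esp d => μ (Metric.ball q.2 q.1) := by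
  have hs : MeasurableSet {p : (ℝ × Esp d) × Esp d | dist p.2 p.1.2 < p.1.1} :=
    measurableSet_lt (by fun_prop) (by fun_prop)
  exact measurable_measure_prodMk_left hs

/-- The integral of `μ(B(z,r))²` over all balls. -/
def ballEnergy (d : ℕ) (μ : Measure (Esp d)) : ℝ≥0∞ :=
  ∫⁻ q, μ (Metric.ball q.2 q.1) ^ 2 ∂ballMeasure d

theorem exists_doubleEnergy_eq_mul_ballEnergy {d : ℕ} (hd : 3 ≤ d) :
    ∃ C : ℝ≥0∞, C ≠ 0 ∧ C ≠ ⊤ ∧ ∀ μ : Measure (Esp d), SFinite μ →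
      doubleEnergy d μ = C * ballEnergy d μ := by
  obtain ⟨C, hC0, hCt, hC⟩ := exists_ballKernel_eq_mul_coulK hd
  refine ⟨C⁻¹, ENNReal.inv_ne_zero.2 hCt, ENNReal.inv_ne_top.2 hC0, fun μ hμ => ?_⟩
  set T : Set ((Esp d × Esp d) × (ℝ × Esp d)) :=
    {x | dist x.2.2 x.1.1 < x.2.1 ∧ dist x.2.2 x.1.2 < x.2.1}
  have hT : MeasurableSet T := by
    apply MeasurableSet.inter
    · exact measurableSet_lt (f := fun x : (Esp d × Esp d) × (ℝ × Esp d) => dist x.2.2 x.1.1)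
        (by fun_prop) (by fun_prop)
    · exact measurableSet_lt (f := fun x : (Esp d × Esp d) × (ℝ × Esp d) => dist x.2.2 x.1.2)
        (by fun_prop) (by fun_prop)
  have h1 : ((μ.prod μ).prod (ballMeasure d)) T = C * doubleEnergy d μ := by
    rw [Measure.prod_apply hT, doubleEnergy, ← lintegral_const_mul' _ _ hCt]
    congr 1 with p
    rw [← hC, ballMeasure, Measure.prod_apply (measurable_prodMk_left hT), ballKernel]
    congr 1 with r
    rw [← measure_preimage_add_right volume p.2 (Prod.mk r ⁻¹' (Prod.mk p ⁻¹' T))]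
    congr 1
    ext z
    simp [T, dist_eq_norm, and_comm, sub_sub_eq_add_sub]
  have h2 : ((μ.prod μ).prod (ballMeasure d)) T = ballEnergy d μ := by
    rw [Measure.prod_apply_symm hT, ballEnergy]
    congr 1 with q
    rw [sq, ← Measure.prod_prod]
    congr 1 with p
    simp [T, dist_comm]
  rw [← h2, h1, ← mul_assoc, ENNReal.inv_mul_cancel hC0 hCt, one_mul]

theorem ext_of_measure_closedBall {d : ℕ} {μ ν : Measure (Esp d)} [IsFiniteMeasure μ]
    [IsFiniteMeasure ν]
    (h : ∀ z r, 0 < r → μ (Metric.closedBall z r) = ν (Metric.closedBall z r)) : μ = ν := by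
  have h1 := Besicovitch.ae_tendsto_rnDeriv μ (μ + ν)
  have h2 := Besicovitch.ae_tendsto_rnDeriv ν (μ + ν)
  have h3 : μ.rnDeriv (μ + ν) =ᵐ[μ + ν] ν.rnDeriv (μ + ν) := by
    filter_upwards [h1, h2] with x hx1 hx2
    refine tendsto_nhds_unique hx1 (hx2.congr' ?_)
    filter_upwards [self_mem_nhdsWithin] with r hr
    rw [h x r hr]
  have := Measure.haveLebesgueDecomposition_of_sigmaFinite μ (μ + ν)
  have := Measure.haveLebesgueDecomposition_of_sigmaFinite ν (μ + ν)
  exact (Measure.withDensity_rnDeriv_eq μ (μ + ν)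
      (Measure.le_add_right le_rfl).absolutelyContinuous).symm.trans
    ((withDensity_congr_ae h3).trans (Measure.withDensity_rnDeriv_eq ν (μ + ν)
      (Measure.le_add_left le_rfl).absolutelyContinuous))

theorem measure_closedBall_le_of_ae_eq_ball {d : ℕ} {μ ν : Measure (Esp d)} [IsFiniteMeasure μ]
    [IsFiniteMeasure ν]
    (h : ∀ᵐ q ∂ballMeasure d, μ (Metric.ball q.2 q.1) = ν (Metric.ball q.2 q.1))
    (z : Esp d) {r : ℝ} (hr : 0 < r) :
    μ (Metric.closedBall z r) ≤ ν (Metric.closedBall z r) := by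
  have key (ε : ℝ) (hε : 0 < ε) :
      μ (Metric.closedBall z r) ≤ ν (Metric.cthickening ε (Metric.closedBall z r)) := by
    have hU : ballMeasure d (Set.Ioo (r + ε / 3) (r + 2 * ε / 3) ×ˢ Metric.ball z (ε / 3)) ≠ 0 := by
      rw [ballMeasure, Measure.prod_prod]
      exact mul_ne_zero (radiusMeasure_Ioo_pos d (by positivity) (by linarith)).ne'
        (Metric.measure_ball_pos _ _ (by positivity)).ne'
    obtain ⟨q, hq, hq'⟩ : ∃ q ∈ Set.Ioo (r + ε / 3) (r + 2 * ε / 3) ×ˢ Metric.ball z (ε / 3),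
        μ (Metric.ball q.2 q.1) = ν (Metric.ball q.2 q.1) := by
      by_contra! hcon
      exact hU (measure_mono_null hcon h)
    obtain ⟨⟨h1, h2⟩, h3⟩ := hq
    rw [Metric.mem_ball] at h3
    rw [cthickening_closedBall hε.le hr.le]
    calc _ ≤ μ (Metric.ball q.2 q.1) := measure_mono fun w hw => by
          rw [Metric.mem_closedBall] at hw
          rw [Metric.mem_ball]
          linarith [dist_triangle_right w q.2 z]
      _ = ν (Metric.ball q.2 q.1) := hq'
      _ ≤ _ := measure_mono fun w hw => by
          rw [Metric.mem_ball] at hw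
          rw [Metric.mem_closedBall]
          linarith [dist_triangle w q.2 z]
  have ht := tendsto_measure_cthickening_of_isClosed (μ := ν) (s := Metric.closedBall z r)
    ⟨1, one_pos, measure_ne_top _ _⟩ Metric.isClosed_closedBall
  exact ge_of_tendsto (ht.mono_left nhdsWithin_le_nhds)
    ((eventually_mem_nhdsWithin (s := Set.Ioi 0)).mono fun ε hε => key ε hε)

theorem ext_of_ae_eq_ball {d : ℕ} {μ ν : Measure (Esp d)} [IsFiniteMeasure μ] [IsFiniteMeasure ν]
    (h : ∀ᵐ q ∂ballMeasure d, μ (Metric.ball q.2 q.1) = ν (Metric.ball q.2 q.1)) : μ = ν :=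
  ext_of_measure_closedBall fun z _ hr =>
    (measure_closedBall_le_of_ae_eq_ball h z hr).antisymm
      (measure_closedBall_le_of_ae_eq_ball (h.mono fun _ hq => hq.symm) z hr)

theorem ENNReal.midpoint_sq_add {a b : ℝ≥0∞} (ha : a ≠ ⊤) (hb : b ≠ ⊤) :
    (2⁻¹ * (a + b)) ^ 2 + ENNReal.ofReal (((a.toReal - b.toReal) / 2) ^ 2)
      = 2⁻¹ * (a ^ 2 + b ^ 2) := by
  lift a to NNReal using ha
  lift b to NNReal using hb
  rw [← ENNReal.toReal_eq_toReal_iff' (by finiteness) (by finiteness),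
    ENNReal.toReal_add (by finiteness) (by finiteness),
    ENNReal.toReal_ofReal (by positivity)]
  simp [ENNReal.toReal_add]
  ring

/-- The midpoint of two measures. -/
def midMeasure {d : ℕ} (μ ν : Measure (Esp d)) : Measure (Esp d) := (2⁻¹ : ℝ≥0∞) • (μ + ν)

instance {d : ℕ} (μ ν : Measure (Esp d)) [IsProbabilityMeasure μ] [IsProbabilityMeasure ν] :
    IsProbabilityMeasure (midMeasure μ ν) :=
  ⟨by simp [midMeasure, ENNReal.inv_two_add_inv_two]⟩

theorem exists_ballEnergy_midMeasure_add {d : ℕ} (μ ν : Measure (Esp d)) [IsProbabilityMeasure μ]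
    [IsProbabilityMeasure ν] :
    ∃ D : ℝ≥0∞, ballEnergy d (midMeasure μ ν) + D = 2⁻¹ * (ballEnergy d μ + ballEnergy d ν) ∧
      (D = 0 → μ = ν) := by
  have hμ := measurable_measure_ball μ
  have hν := measurable_measure_ball ν
  refine ⟨∫⁻ q, ENNReal.ofReal ((((μ (Metric.ball q.2 q.1)).toReal
     - (ν (Metric.ball q.2 q.1)).toReal) / 2) ^ 2) ∂ballMeasure d, ?_, fun h => ?_⟩
  · rw [ballEnergy, ballEnergy, ballEnergy,
      ← lintegral_add_left ((measurable_measure_ball _).pow_const 2),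
      ← lintegral_add_left (hμ.pow_const 2), ← lintegral_const_mul' _ _ (by simp)]
    congr 1 with q
    rw [← ENNReal.midpoint_sq_add (measure_ne_top _ _) (measure_ne_top _ _)]
    simp [midMeasure, mul_add]
  · have hm : Measurable fun q : ℝ × Esp d => ENNReal.ofReal ((((μ (Metric.ball q.2 q.1)).toReal
        - (ν (Metric.ball q.2 q.1)).toReal) / 2) ^ 2) :=
      (((hμ.ennreal_toReal.sub hν.ennreal_toReal).div_const 2).pow_const 2).ennreal_ofReal
    rw [lintegral_eq_zero_iff hm] at h
    refine ext_of_ae_eq_ball (h.mono fun q hq => ?_)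
    rw [Pi.zero_apply, ENNReal.ofReal_eq_zero] at hq
    have h0 := pow_eq_zero_iff (two_ne_zero) |>.1 (le_antisymm hq (sq_nonneg _))
    exact (ENNReal.toReal_eq_toReal_iff' (measure_ne_top _ _) (measure_ne_top _ _)).1 (by linarith)

theorem lintegral_eq_lintegral_measure_ofReal_lt {α : Type*} [MeasurableSpace α] (μ : Measure α)
    [SFinite μ] {f : α → ℝ≥0∞} (hf : Measurable f) :
    ∫⁻ x, f x ∂μ = ∫⁻ t in Set.Ioi (0 : ℝ), μ {x | ENNReal.ofReal t < f x} := by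
  have hT : MeasurableSet {p : α × ℝ | ENNReal.ofReal p.2 < f p.1} :=
    measurableSet_lt (by fun_prop) (by fun_prop)
  have h := (Measure.prod_apply (μ := μ) (ν := volume.restrict (Set.Ioi (0 : ℝ))) hT).symm.trans
    (Measure.prod_apply_symm hT)
  refine Eq.trans ?_ h
  congr 1 with x
  rw [Measure.restrict_apply (measurable_prodMk_left hT)]
  rcases eq_or_ne (f x) ⊤ with hx | hx
  · rw [show Prod.mk x ⁻¹' {p : α × ℝ | ENNReal.ofReal p.2 < f p.1} ∩ Set.Ioi 0 = Set.Ioi 0 by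
      ext t; simp [hx], Real.volume_Ioi, hx]
  · rw [show Prod.mk x ⁻¹' {p : α × ℝ | ENNReal.ofReal p.2 < f p.1} ∩ Set.Ioi 0
      = Set.Ioo 0 (f x).toReal by
        ext t
        simp only [Set.mem_inter_iff, Set.mem_preimage, Set.mem_ofPred_eq, Set.mem_Ioi, Set.mem_Ioo]
        rw [and_comm, and_congr_right_iff]
        intro ht
        exact ENNReal.ofReal_lt_iff_lt_toReal ht.le hx,
      Real.volume_Ioo, sub_zero, ENNReal.ofReal_toReal hx]

theorem lintegral_le_liminf_of_lowerSemicontinuous {d : ℕ} {f : Esp d → ℝ≥0∞}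
    (hf : LowerSemicontinuous f) {μs : ℕ → ProbabilityMeasure (Esp d)}
    {μ : ProbabilityMeasure (Esp d)} (h : Tendsto μs atTop (𝓝 μ)) :
    ∫⁻ x, f x ∂(μ : Measure (Esp d))
      ≤ liminf (fun n => ∫⁻ x, f x ∂(μs n : Measure (Esp d))) atTop := by
  simp_rw [lintegral_eq_lintegral_measure_ofReal_lt _ hf.measurable]
  refine (lintegral_mono fun t => ?_).trans (lintegral_liminf_le fun n => ?_)
  · exact ProbabilityMeasure.le_liminf_measure_open_of_tendsto h (hf.isOpen_preimage _)
  · exact Antitone.measurable fun s t hst => measure_mono fun x hx =>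
      (ENNReal.ofReal_le_ofReal hst).trans_lt hx

theorem ballEnergy_le_liminf {d : ℕ} {μs : ℕ → ProbabilityMeasure (Esp d)}
    {μ : ProbabilityMeasure (Esp d)} (h : Tendsto μs atTop (𝓝 μ)) :
    ballEnergy d μ ≤ liminf (fun n => ballEnergy d (μs n)) atTop := by
  unfold ballEnergy
  refine (lintegral_mono fun q => ?_).trans
    (lintegral_liminf_le fun n => (measurable_measure_ball _).pow_const 2)
  have h1 := ProbabilityMeasure.le_liminf_measure_open_of_tendsto h
    (Metric.isOpen_ball (x := q.2) (ε := q.1))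
  refine (pow_le_pow_left' h1 2).trans_eq ?_
  exact Monotone.map_liminf_of_continuousAt (f := fun x : ℝ≥0∞ => x ^ 2)
    (fun a b hab => pow_le_pow_left' hab 2) _ (ENNReal.continuous_pow 2).continuousAt

theorem ENNReal.liminf_add_liminf_le (u v : ℕ → ℝ≥0∞) :
    liminf u atTop + liminf v atTop ≤ liminf (fun n => u n + v n) atTop := by
  simp_rw [liminf_eq_iSup_iInf_of_nat]
  have hmono (w : ℕ → ℝ≥0∞) : Monotone fun n => ⨅ i, ⨅ (_ : i ≥ n), w i :=
    fun a b hab => le_iInf₂ fun i hi => iInf₂_le i (hab.trans hi)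
  rw [ENNReal.iSup_add_iSup_of_monotone (hmono u) (hmono v)]
  exact iSup_mono fun n => le_iInf₂ fun i hi => add_le_add (iInf₂_le i hi) (iInf₂_le i hi)

/-- The energy of `μ` in the external potential `W ≥ 0`. -/
def potentialEnergy (d : ℕ) (W : Esp d → ℝ≥0∞) (μ : Measure (Esp d)) : ℝ≥0∞ :=
  doubleEnergy d μ + ∫⁻ x, W x ∂μ

theorem potentialEnergy_le_liminf {d : ℕ} (hd : 3 ≤ d) {W : Esp d → ℝ≥0∞}
    (hW : LowerSemicontinuous W) {μs : ℕ → ProbabilityMeasure (Esp d)}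
    {μ : ProbabilityMeasure (Esp d)} (h : Tendsto μs atTop (𝓝 μ)) :
    potentialEnergy d W μ ≤ liminf (fun n => potentialEnergy d W (μs n)) atTop := by
  obtain ⟨C, -, hCt, hC⟩ := exists_doubleEnergy_eq_mul_ballEnergy hd
  refine le_trans ?_ (ENNReal.liminf_add_liminf_le _ _)
  refine add_le_add ?_ (lintegral_le_liminf_of_lowerSemicontinuous hW h)
  simp_rw [fun n => hC (μs n : Measure (Esp d)) inferInstance]
  rw [hC μ inferInstance]
  refine (mul_le_mul_right (ballEnergy_le_liminf h) C).trans_eq ?_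
  exact Monotone.map_liminf_of_continuousAt (f := fun x : ℝ≥0∞ => C * x)
    (fun a b hab => mul_le_mul_right hab C) _ (ENNReal.continuous_const_mul hCt).continuousAt

theorem measure_sublevel_compl_le_div {d : ℕ} {W : Esp d → ℝ≥0∞} (hW : LowerSemicontinuous W)
    (μ : Measure (Esp d)) {M : ℝ≥0∞} (hM0 : M ≠ 0) (hM : M ≠ ⊤) :
    μ {x | W x ≤ M}ᶜ ≤ potentialEnergy d W μ / M := by
  calc μ {x | W x ≤ M}ᶜ
      ≤ μ {x | M ≤ W x} := measure_mono fun x hx => (not_le.1 (show ¬W x ≤ M from hx)).le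
    _ ≤ (∫⁻ x, W x ∂μ) / M := meas_ge_le_lintegral_div hW.measurable.aemeasurable hM0 hM
    _ ≤ _ := ENNReal.div_le_div_right le_add_self M

theorem exists_minimizer_potentialEnergy {d : ℕ} (hd : 3 ≤ d) {W : Esp d → ℝ≥0∞}
    (hW : LowerSemicontinuous W) (hK : ∀ M : ℝ≥0∞, M ≠ ⊤ → IsCompact {x | W x ≤ M})
    (hfin : ∃ ν : Measure (Esp d), IsProbabilityMeasure ν ∧ potentialEnergy d W ν ≠ ⊤) :
    ∃ μ : Measure (Esp d), IsProbabilityMeasure μ ∧ potentialEnergy d W μ ≠ ⊤ ∧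
      ∀ ν : Measure (Esp d), IsProbabilityMeasure ν →
        potentialEnergy d W μ ≤ potentialEnergy d W ν := by
  obtain ⟨ν₀, hν₀, hν₀t⟩ := hfin
  set m : ℝ≥0∞ := ⨅ ν : ProbabilityMeasure (Esp d), potentialEnergy d W ν
  have hmle (ν : Measure (Esp d)) (hν : IsProbabilityMeasure ν) : m ≤ potentialEnergy d W ν :=
    iInf_le (fun ν : ProbabilityMeasure (Esp d) => potentialEnergy d W ν) ⟨ν, hν⟩
  have hmt : m ≠ ⊤ := ne_top_of_le_ne_top hν₀t (hmle ν₀ hν₀)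
  have : Nonempty (ProbabilityMeasure (Esp d)) := ⟨⟨ν₀, hν₀⟩⟩
  obtain ⟨u, -, hut, hu⟩ := exists_seq_tendsto_sInf
    (S := Set.range fun ν : ProbabilityMeasure (Esp d) => potentialEnergy d W ν)
    (Set.range_nonempty _) (OrderBot.bddBelow _)
  choose μs hμs using hu
  simp only at hμs
  change Tendsto u atTop (𝓝 m) at hut
  have hcpt : IsCompact (closure {ν : ProbabilityMeasure (Esp d) |
      potentialEnergy d W ν ≤ m + 1}) := by
    refine isCompact_closure_of_isTightMeasureSet
      (isTightMeasureSet_iff_exists_isCompact_measure_compl_le.2 fun ε hε => ?_)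
    have hMt : (m + 1) / ε + 1 ≠ ⊤ := by
      simp [ENNReal.div_eq_top, hmt, hε.ne']
    refine ⟨{x | W x ≤ (m + 1) / ε + 1}, hK _ hMt, ?_⟩
    rintro _ ⟨ν, hν, rfl⟩
    refine (measure_sublevel_compl_le_div hW ν (by simp) hMt).trans (ENNReal.div_le_of_le_mul ?_)
    rcases eq_or_ne ε ⊤ with rfl | hεt
    · simp
    · calc potentialEnergy d W ν ≤ m + 1 := hν
        _ = ε * ((m + 1) / ε) := (ENNReal.mul_div_cancel hε.ne' hεt).symm
        _ ≤ _ := by gcongr; exact le_self_add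
  have hev : ∀ᶠ n in atTop, μs n ∈ closure {ν : ProbabilityMeasure (Esp d) |
      potentialEnergy d W ν ≤ m + 1} := by
    filter_upwards [hut.eventually_le_const (ENNReal.lt_add_right hmt one_ne_zero)] with n hn
    exact subset_closure ((hμs n).trans_le hn)
  obtain ⟨μ, -, φ, hφ, hμ⟩ := hcpt.tendsto_subseq' hev.frequently
  have hle : potentialEnergy d W μ ≤ m := by
    refine (potentialEnergy_le_liminf hd hW hμ).trans_eq ?_
    simp_rw [Function.comp_apply, hμs]
    exact (hut.comp hφ.tendsto_atTop).liminf_eq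
  exact ⟨μ, inferInstance, ne_top_of_le_ne_top hmt hle, fun ν hν => hle.trans (hmle ν hν)⟩

theorem eq_of_minimizers {d : ℕ} (hd : 3 ≤ d) {W : Esp d → ℝ≥0∞}
    {μ ν : Measure (Esp d)} [IsProbabilityMeasure μ] [IsProbabilityMeasure ν]
    (hμt : potentialEnergy d W μ ≠ ⊤)
    (hμ : ∀ ρ : Measure (Esp d), IsProbabilityMeasure ρ →
        potentialEnergy d W μ ≤ potentialEnergy d W ρ)
    (hν : potentialEnergy d W ν = potentialEnergy d W μ) : ν = μ := by
  obtain ⟨C, hC0, hCt, hC⟩ := exists_doubleEnergy_eq_mul_ballEnergy hd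
  obtain ⟨D, hD, hD0⟩ := exists_ballEnergy_midMeasure_add ν μ
  refine hD0 ?_
  have h1 : potentialEnergy d W (midMeasure ν μ) + C * D = potentialEnergy d W μ := by
    have h2 : potentialEnergy d W (midMeasure ν μ) + C * D
        = 2⁻¹ * (potentialEnergy d W ν + potentialEnergy d W μ) := by
      unfold potentialEnergy
      rw [hC _ inferInstance, hC ν inferInstance, hC μ inferInstance, add_right_comm, ← mul_add, hD,
        midMeasure, lintegral_smul_measure, lintegral_add_measure, smul_eq_mul]
      ring
    rw [h2, hν, ← two_mul, ← mul_assoc, ENNReal.inv_mul_cancel two_ne_zero ENNReal.ofNat_ne_top,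
      one_mul]
  have h2 := hμ (midMeasure ν μ) inferInstance
  rw [← h1] at h2 hμt
  have h3 : C * D = 0 := by
    have h4 : potentialEnergy d W (midMeasure ν μ) ≠ ⊤ := ne_top_of_le_ne_top hμt le_self_add
    refine nonpos_iff_eq_zero.1 ((ENNReal.add_le_add_iff_left h4).1 ?_)
    rwa [add_zero]
  exact (mul_eq_zero.1 h3).resolve_left hC0

theorem doubleEnergy_mono {d : ℕ} {μ ν : Measure (Esp d)} [SFinite μ] [SFinite ν] (h : μ ≤ ν) :
    doubleEnergy d μ ≤ doubleEnergy d ν :=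
  lintegral_mono' (Measure.prod_mono h h) le_rfl

theorem measurable_coulK (d : ℕ) : Measurable (coulK d) := by
  unfold coulK
  fun_prop

theorem sq_mul_doubleEnergy_cond_le {d : ℕ} (μ : Measure (Esp d)) [IsProbabilityMeasure μ]
    {K : Set (Esp d)} (hK : μ K ≠ 0) :
    μ K ^ 2 * doubleEnergy d (ProbabilityTheory.cond μ K) ≤ doubleEnergy d μ := by
  have h : doubleEnergy d (ProbabilityTheory.cond μ K)
      = (μ K)⁻¹ ^ 2 * doubleEnergy d (μ.restrict K) := by
    unfold doubleEnergy ProbabilityTheory.cond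
    rw [Measure.prod_smul_left, Measure.prod_smul_right, lintegral_smul_measure,
      lintegral_smul_measure, smul_eq_mul, smul_eq_mul, sq, mul_assoc]
  rw [h, ← mul_assoc, ← mul_pow, ENNReal.mul_inv_cancel hK (measure_ne_top _ _), one_pow, one_mul]
  exact doubleEnergy_mono Measure.restrict_le_self

theorem measure_compl_eq_zero_of_minimizer {d : ℕ} {W : Esp d → ℝ≥0∞}
    (hW : LowerSemicontinuous W) {μ : Measure (Esp d)} [IsProbabilityMeasure μ]
    (hμt : potentialEnergy d W μ ≠ ⊤)
    (hμ : ∀ ρ : Measure (Esp d), IsProbabilityMeasure ρ →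
        potentialEnergy d W μ ≤ potentialEnergy d W ρ) :
    μ {x | W x ≤ 2 * potentialEnergy d W μ + 1}ᶜ = 0 := by
  set m := potentialEnergy d W μ with hm
  set K := {x | W x ≤ 2 * m + 1}
  have hKm : MeasurableSet K := hW.measurable measurableSet_Iic
  have hE : doubleEnergy d μ ≠ ⊤ := ne_top_of_le_ne_top hμt le_self_add
  have hsplit : ∫⁻ x in K, W x ∂μ + ∫⁻ x in Kᶜ, W x ∂μ = ∫⁻ x, W x ∂μ :=
    lintegral_add_compl _ hKm
  have hWt : ∫⁻ x, W x ∂μ ≠ ⊤ := ne_top_of_le_ne_top hμt le_add_self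
  have hA : ∫⁻ x in K, W x ∂μ ≠ ⊤ := ne_top_of_le_ne_top hWt (hsplit ▸ le_self_add)
  have hB : ∫⁻ x in Kᶜ, W x ∂μ ≠ ⊤ := ne_top_of_le_ne_top hWt (hsplit ▸ le_add_self)
  have hBM : (2 * m + 1) * μ Kᶜ ≤ ∫⁻ x in Kᶜ, W x ∂μ := by
    rw [← setLIntegral_const]
    exact setLIntegral_mono' hKm.compl fun x hx => (not_le.1 (show ¬W x ≤ 2 * m + 1 from hx)).le
  have hsum : μ K + μ Kᶜ = 1 := by rw [measure_add_measure_compl hKm, measure_univ]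
  have hmsum : m = doubleEnergy d μ + (∫⁻ x in K, W x ∂μ + ∫⁻ x in Kᶜ, W x ∂μ) := by
    rw [hsplit, hm, potentialEnergy]
  have hcmp : μ K ^ 2 * m ≤ doubleEnergy d μ + μ K * ∫⁻ x in K, W x ∂μ := by
    rcases eq_or_ne (μ K) 0 with h0 | h0
    · simp [h0]
    have := ProbabilityTheory.cond_isProbabilityMeasure h0
    calc μ K ^ 2 * m ≤ μ K ^ 2 * potentialEnergy d W (ProbabilityTheory.cond μ K) := by
          gcongr; exact hμ _ this
      _ = μ K ^ 2 * doubleEnergy d (ProbabilityTheory.cond μ K)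
          + μ K * (μ K * (μ K)⁻¹) * ∫⁻ x in K, W x ∂μ := by
        rw [potentialEnergy, mul_add]
        congr 1
        rw [ProbabilityTheory.cond, lintegral_smul_measure, smul_eq_mul]
        ring
      _ ≤ _ := by
        rw [ENNReal.mul_inv_cancel h0 (measure_ne_top _ _), mul_one]
        gcongr
        exact sq_mul_doubleEnergy_cond_le μ h0
  generalize doubleEnergy d μ = e at *
  generalize ∫⁻ x in K, W x ∂μ = a at *
  generalize ∫⁻ x in Kᶜ, W x ∂μ = b at *
  have ht := measure_ne_top μ K
  have hs := measure_ne_top μ Kᶜ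
  clear_value m
  generalize μ K = t at *
  generalize μ Kᶜ = s at *
  lift e to NNReal using hE
  lift a to NNReal using hA
  lift b to NNReal using hB
  lift m to NNReal using hμt
  lift t to NNReal using ht
  lift s to NNReal using hs
  norm_cast at *
  have hbm' : (2 * m + 1 : ℝ) * s ≤ b := by exact_mod_cast hBM
  have hsum' : (t + s : ℝ) = 1 := by exact_mod_cast hsum
  have hm' : (m : ℝ) = e + (a + b) := by exact_mod_cast hmsum
  have hc' : (t ^ 2 * m : ℝ) ≤ e + t * a := by exact_mod_cast hcmp
  have hs0 := s.2
  have ht0 := t.2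
  have ha0 := a.2
  have hm0 := m.2
  have : (s : ℝ) ≤ 0 := by
    have : (t : ℝ) * a ≤ a := by nlinarith
    have h : (t : ℝ) = 1 - s := by linarith
    have h2 : (t : ℝ) ^ 2 * m = m - 2 * m * s + s ^ 2 * m := by rw [h]; ring
    nlinarith [mul_nonneg (sq_nonneg (s : ℝ)) hm0]
  exact_mod_cast le_antisymm this hs0

theorem setLIntegral_coulK_ball_ne_top {d : ℕ} (hd : 3 ≤ d) :
    ∫⁻ x in Metric.ball 0 1, coulK d x ≠ ⊤ := by
  have : Nontrivial (Esp d) := by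
    have : Nonempty (Fin d) := ⟨⟨0, by omega⟩⟩
    infer_instance
  have hae : ∀ᵐ x : Esp d, coulK d x = ENNReal.ofReal (‖x‖ ^ (2 - (d : ℝ))) := by
    filter_upwards [compl_mem_ae_iff.2 (measure_singleton (0 : Esp d))] with x hx
    exact coulK_of_ne_zero d hx
  rw [lintegral_congr_ae (ae_restrict_of_ae hae)]
  have hi : IntegrableOn (fun x : Esp d => ‖x‖ ^ (2 - (d : ℝ))) (Metric.ball 0 1) := by
    rw [integrableOn_fun_norm_addHaar volume (f := fun r : ℝ => r ^ (2 - (d : ℝ)))]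
    have h1 : IntegrableOn (fun y : ℝ => y) (Set.Ioo 0 1) :=
      (continuous_id.integrableOn_Icc (a := 0) (b := 1)).mono_set Set.Ioo_subset_Icc_self
    refine h1.congr_fun (fun y hy => ?_) measurableSet_Ioo
    rw [finrank_euclideanSpace_fin, smul_eq_mul, ← Real.rpow_natCast, ← Real.rpow_add hy.1,
      Nat.cast_sub (by omega)]
    norm_num
  exact hi.lintegral_lt_top.ne

theorem coulK_le_one {d : ℕ} (hd : 3 ≤ d) {x : Esp d} (hx : x ∉ Metric.ball 0 1) :
    coulK d x ≤ 1 := by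
  have hd' : (3 : ℝ) ≤ d := by exact_mod_cast hd
  have hx : 1 ≤ ‖x‖ := by simpa using hx
  rw [coulK_of_ne_zero d (norm_pos_iff.1 (by linarith)), ENNReal.ofReal_le_one]
  exact Real.rpow_le_one_of_one_le_of_nonpos hx (by linarith)

theorem doubleEnergy_ne_top_of_le_smul_volume {d : ℕ} (hd : 3 ≤ d) {ν : Measure (Esp d)}
    [IsProbabilityMeasure ν] {c : ℝ≥0∞} (hc : c ≠ ⊤) (hν : ν ≤ c • volume) :
    doubleEnergy d ν ≠ ⊤ := by
  have hle (x : Esp d) : ∫⁻ y, coulK d (x - y) ∂ν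
      ≤ c * (∫⁻ x in Metric.ball 0 1, coulK d x) + 1 := by
    calc ∫⁻ y, coulK d (x - y) ∂ν
        ≤ ∫⁻ y, ((Metric.ball (0 : Esp d) 1).indicator (coulK d) (x - y) + 1) ∂ν := by
          refine lintegral_mono fun y => ?_
          by_cases h : x - y ∈ Metric.ball (0 : Esp d) 1
          · rw [Set.indicator_of_mem h]; exact le_self_add
          · exact (coulK_le_one hd h).trans le_add_self
      _ = ∫⁻ y, (Metric.ball (0 : Esp d) 1).indicator (coulK d) (x - y) ∂ν + 1 := by
          rw [lintegral_add_right _ measurable_const]; simp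
      _ ≤ ∫⁻ y, (Metric.ball (0 : Esp d) 1).indicator (coulK d) (x - y) ∂(c • volume) + 1 := by
          gcongr
      _ = _ := by
          rw [lintegral_smul_measure,
            lintegral_sub_left_eq_self ((Metric.ball (0 : Esp d) 1).indicator (coulK d)) x,
            lintegral_indicator measurableSet_ball, smul_eq_mul]
  have h : doubleEnergy d ν = ∫⁻ x, ∫⁻ y, coulK d (x - y) ∂ν ∂ν :=
    lintegral_prod _ ((measurable_coulK d).comp (by fun_prop)).aemeasurable
  rw [h]
  refine ne_top_of_le_ne_top ?_ (lintegral_mono hle)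
  simpa using ENNReal.mul_ne_top hc (setLIntegral_coulK_ball_ne_top hd)

theorem exists_potentialEnergy_ne_top {d : ℕ} (hd : 3 ≤ d) {W : Esp d → ℝ≥0∞}
    (hW : Measurable W) (h : volume {x | W x ≠ ⊤} ≠ 0) :
    ∃ ν : Measure (Esp d), IsProbabilityMeasure ν ∧ potentialEnergy d W ν ≠ ⊤ := by
  obtain ⟨n, hn⟩ : ∃ n : ℕ, volume ({x | W x ≤ n} ∩ Metric.closedBall (0 : Esp d) n) ≠ 0 := by
    by_contra! hcon
    refine h (measure_mono_null (fun x hx => ?_) (measure_iUnion_null hcon))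
    obtain ⟨n, hn⟩ := ENNReal.exists_nat_gt hx
    obtain ⟨k, hk⟩ := exists_nat_ge ‖x‖
    refine Set.mem_iUnion.2 ⟨max n k, hn.le.trans (by simp), ?_⟩
    rw [mem_closedBall_zero_iff]
    exact hk.trans (by simp)
  set A := {x | W x ≤ n} ∩ Metric.closedBall (0 : Esp d) n
  have hA : MeasurableSet A := (hW measurableSet_Iic).inter measurableSet_closedBall
  have hAt : volume A ≠ ⊤ :=
    ne_top_of_le_ne_top measure_closedBall_lt_top.ne (measure_mono Set.inter_subset_right)
  have hp := ProbabilityTheory.cond_isProbabilityMeasure_of_finite hn hAt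
  refine ⟨_, hp, ENNReal.add_ne_top.2
    ⟨doubleEnergy_ne_top_of_le_smul_volume hd (ENNReal.inv_ne_top.2 hn) ?_, ?_⟩⟩
  · refine Measure.le_iff.2 fun s _ => ?_
    simp only [ProbabilityTheory.cond, Measure.smul_apply, smul_eq_mul]
    gcongr
    exact Measure.restrict_le_self
  · refine ne_top_of_le_ne_top (ENNReal.natCast_ne_top n) ?_
    calc ∫⁻ x, W x ∂ProbabilityTheory.cond volume A
        ≤ ∫⁻ _, n ∂ProbabilityTheory.cond volume A :=
          lintegral_mono_ae ((ProbabilityTheory.ae_cond_mem hA).mono fun x hx => hx.1)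
      _ = n := by simp

/-- `V + b` as a nonnegative extended function. -/
def shiftPotential {d : ℕ} (V : Esp d → EReal) (b : ℝ) (x : Esp d) : ℝ≥0∞ :=
  (V x + (b : EReal)).toENNReal

theorem lowerSemicontinuous_shiftPotential {d : ℕ} {V : Esp d → EReal}
    (hV : LowerSemicontinuous V) (b : ℝ) : LowerSemicontinuous (shiftPotential V b) := by
  have h1 : Continuous fun v : EReal => (v + (b : EReal)).toENNReal := by
    refine EReal.continuous_toENNReal.comp (continuous_iff_continuousAt.2 fun v => ?_)
    exact (EReal.continuousAt_add (Or.inr (EReal.coe_ne_bot b)) (Or.inr (EReal.coe_ne_top b))).comp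
      (continuousAt_id.prodMk continuousAt_const)
  exact h1.comp_lowerSemicontinuous hV fun u v huv => by
    exact EReal.toENNReal_le_toENNReal (add_le_add_left huv _)

theorem IV_eq {d : ℕ} {V : Esp d → EReal} (hV : LowerSemicontinuous V) {b : ℝ} (hb : 0 ≤ b)
    (hVb : ∀ x, ((-b : ℝ) : EReal) ≤ V x) (μ : Measure (Esp d)) [IsProbabilityMeasure μ] :
    IV d V μ = (potentialEnergy d (shiftPotential V b) μ : EReal) + ((-b : ℝ) : EReal) := by
  have hbot (x) : V x ≠ ⊥ := ((EReal.bot_lt_coe _).trans_le (hVb x)).ne'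
  set p : Esp d → ℝ≥0∞ := fun x => if V x = ⊤ then ⊤ else ENNReal.ofReal (V x).toReal
  set n : Esp d → ℝ≥0∞ := fun x => if V x = ⊥ then ⊤ else ENNReal.ofReal (-(V x)).toReal
  have hpt (x) : shiftPotential V b x + n x = p x + ENNReal.ofReal b ∧ n x ≤ ENNReal.ofReal b := by
    simp only [shiftPotential, p, n, if_neg (hbot x)]
    have h1 := hVb x
    have h2 := hbot x
    generalize V x = v at h1 h2 ⊢
    induction v with
    | bot => exact absurd rfl h2
    | top => simp
    | coe v =>
      have h1 : -b ≤ v := by exact_mod_cast h1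
      rw [if_neg (EReal.coe_ne_top v), ← EReal.coe_add, EReal.real_coe_toENNReal, ← EReal.coe_neg,
        EReal.toReal_coe, EReal.toReal_coe]
      refine ⟨?_, ENNReal.ofReal_le_ofReal (by linarith)⟩
      rcases le_total 0 v with hv | hv
      · rw [ENNReal.ofReal_of_nonpos (p := -v) (by linarith), add_zero,
          ← ENNReal.ofReal_add hv hb]
      · rw [ENNReal.ofReal_of_nonpos (p := v) hv, zero_add,
          ← ENNReal.ofReal_add (by linarith) (by linarith)]
        congr 1; ring
  have hint : ∫⁻ x, shiftPotential V b x ∂μ + ∫⁻ x, n x ∂μ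
      = ∫⁻ x, p x ∂μ + ENNReal.ofReal b := by
    rw [← lintegral_add_left (lowerSemicontinuous_shiftPotential hV b).measurable,
      lintegral_congr fun x => (hpt x).1, lintegral_add_right _ measurable_const]
    simp
  have hn : ∫⁻ x, n x ∂μ ≠ ⊤ := by
    refine ne_top_of_le_ne_top (b := ENNReal.ofReal b) ENNReal.ofReal_ne_top ?_
    calc ∫⁻ x, n x ∂μ ≤ ∫⁻ _, ENNReal.ofReal b ∂μ := lintegral_mono fun x => (hpt x).2
      _ = _ := by simp
  have key : ((∫⁻ x, p x ∂μ : ℝ≥0∞) : EReal) - ((∫⁻ x, n x ∂μ : ℝ≥0∞) : EReal)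
      = ((∫⁻ x, shiftPotential V b x ∂μ : ℝ≥0∞) : EReal) + ((-b : ℝ) : EReal) := by
    generalize ∫⁻ x, p x ∂μ = P at *
    generalize ∫⁻ x, n x ∂μ = N at *
    generalize ∫⁻ x, shiftPotential V b x ∂μ = I at *
    lift N to NNReal using hn
    induction I with
    | top =>
      have : P = ⊤ := by simpa using hint.symm
      subst this
      rw [EReal.coe_ennreal_top, EReal.top_add_coe]
      exact EReal.top_sub_coe N
    | coe I =>
      have hP : P ≠ ⊤ := by rintro rfl; simp at hint
      lift P to NNReal using hP
      have h : (I + N : ℝ) = P + b := by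
        have := congrArg ENNReal.toReal hint
        rwa [ENNReal.toReal_add (by simp) (by simp), ENNReal.toReal_add (by simp) (by simp),
          ENNReal.toReal_ofReal hb] at this
      change (((P : ℝ) : EReal) - ((N : ℝ) : EReal)) = ((I : ℝ) : EReal) + _
      rw [← EReal.coe_sub, ← EReal.coe_add]
      congr 1
      linarith
  rw [IV, eIntE, key, potentialEnergy, EReal.coe_ennreal_add, add_assoc]

theorem isCompact_shiftPotential_le {d : ℕ} (hd : 3 ≤ d) {V : Esp d → EReal}
    (hV : LowerSemicontinuous V) {b : ℝ} (hVb : ∀ x, ((-b : ℝ) : EReal) ≤ V x)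
    (hgrowth : Tendsto
      (fun x : Esp d => V x * ((2⁻¹ : ℝ) : EReal) + ((‖x‖ ^ (2 - (d : ℝ)) : ℝ) : EReal))
      (cocompact (Esp d)) (𝓝 (⊤ : EReal))) {M : ℝ≥0∞} (hM : M ≠ ⊤) :
    IsCompact {x | shiftPotential V b x ≤ M} := by
  have hd' : (3 : ℝ) ≤ d := by exact_mod_cast hd
  lift M to NNReal using hM
  have hclosed : IsClosed {x | shiftPotential V b x ≤ M} :=
    (lowerSemicontinuous_shiftPotential hV b).isClosed_preimage _
  have h1 := hgrowth.eventually (lt_mem_nhds (EReal.coe_lt_top ((M - b) * 2⁻¹ + 1)))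
  have h2 : ∀ᶠ x : Esp d in cocompact (Esp d), x ∉ Metric.closedBall 0 1 :=
    (isCompact_closedBall _ _).compl_mem_cocompact
  obtain ⟨K, hK, hKs⟩ := mem_cocompact.1 (h1.and h2)
  refine hK.of_isClosed_subset hclosed fun x hx => ?_
  by_contra hxK
  obtain ⟨h3, h4⟩ := hKs hxK
  have h4 : 1 < ‖x‖ := by simpa using h4
  have h5 : ‖x‖ ^ (2 - (d : ℝ)) ≤ 1 := Real.rpow_le_one_of_one_le_of_nonpos h4.le (by linarith)
  have hx : shiftPotential V b x ≤ M := hx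
  have h6 := hVb x
  rw [shiftPotential] at hx
  generalize V x = v at *
  induction v with
  | bot => simp at h6
  | top => simp at hx
  | coe v =>
    rw [← EReal.coe_add, EReal.real_coe_toENNReal, ENNReal.ofReal_le_coe] at hx
    have h3 : (M - b) * 2⁻¹ + 1 < v * 2⁻¹ + ‖x‖ ^ (2 - (d : ℝ)) := by exact_mod_cast h3
    linarith

/-- existence, finiteness, uniqueness and compact support of the equilibrium
measure, for the Coulomb kernel `g(x) = |x|^(2-d)`, `d ≥ 3`, and a lower semicontinuous,
bounded below potential `V` (with values in `ℝ ∪ {+∞}`), finite on a set of positive Lebesgue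
measure and satisfying the growth condition `V/2 + g → +∞` at infinity. -/
theorem statement_0 (d : ℕ) (hd : 3 ≤ d) (V : Esp d → EReal)
    (hlsc : LowerSemicontinuous V)
    (hbd : ∃ c : ℝ, ∀ x, (c : EReal) ≤ V x)
    (hfin : 0 < volume {x : Esp d | V x ≠ ⊤})
    (hgrowth : Tendsto
      (fun x : Esp d => V x * ((2⁻¹ : ℝ) : EReal) + ((‖x‖ ^ (2 - (d : ℝ)) : ℝ) : EReal))
      (cocompact (Esp d)) (𝓝 (⊤ : EReal))) :
    ∃ μV : Measure (Esp d), IsProbabilityMeasure μV ∧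
      (∀ ν : Measure (Esp d), IsProbabilityMeasure ν → IV d V μV ≤ IV d V ν) ∧
      IV d V μV ≠ ⊤ ∧ IV d V μV ≠ ⊥ ∧
      (∀ ν : Measure (Esp d), IsProbabilityMeasure ν → IV d V ν = IV d V μV → ν = μV) ∧
      (∃ K : Set (Esp d), IsCompact K ∧ μV Kᶜ = 0) := by
  obtain ⟨c, hc⟩ := hbd
  have hVb : ∀ x, ((-|c| : ℝ) : EReal) ≤ V x := fun x =>
    (EReal.coe_le_coe_iff.2 (neg_abs_le c)).trans (hc x)
  set W := shiftPotential V |c|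
  have hW : LowerSemicontinuous W := lowerSemicontinuous_shiftPotential hlsc _
  have hK : ∀ M : ℝ≥0∞, M ≠ ⊤ → IsCompact {x | W x ≤ M} := fun M hM =>
    isCompact_shiftPotential_le hd hlsc hVb hgrowth hM
  have hWfin : volume {x | W x ≠ ⊤} ≠ 0 := by
    refine (hfin.trans_le (measure_mono fun x hx => ?_)).ne'
    change (V x + ((|c| : ℝ) : EReal)).toENNReal ≠ ⊤
    rw [EReal.toENNReal_ne_top_iff]
    exact EReal.add_ne_top hx (EReal.coe_ne_top _)
  obtain ⟨μ, hμ, hμt, hmin⟩ := exists_minimizer_potentialEnergy hd hW hK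
    (exists_potentialEnergy_ne_top hd hW.measurable hWfin)
  have hIV (ν : Measure (Esp d)) (hν : IsProbabilityMeasure ν) :=
    IV_eq hlsc (abs_nonneg c) hVb ν
  refine ⟨μ, hμ, fun ν hν => ?_, ?_, ?_, fun ν hν h => ?_, ?_⟩
  · rw [hIV μ hμ, hIV ν hν]
    exact add_le_add_left (EReal.coe_ennreal_le_coe_ennreal_iff.2 (hmin ν hν)) _
  · rw [hIV μ hμ]
    exact EReal.add_ne_top (by simpa using hμt) (EReal.coe_ne_top _)
  · rw [hIV μ hμ]
    simp [EReal.add_eq_bot_iff]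
  · refine eq_of_minimizers hd hμt hmin ?_
    rw [hIV μ hμ, hIV ν hν] at h
    have h' := congrArg (fun v : EReal => v - ((-|c| : ℝ) : EReal)) h
    simpa only [EReal.add_sub_cancel_right, EReal.coe_ennreal_eq_coe_ennreal_iff] using h'
  · exact ⟨_, hK _ (by finiteness), measure_compl_eq_zero_of_minimizer hW hμt hmin⟩
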